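/- For every constant c > 0 there exists k ∈ ℕ such that for all n ≥ 2 and all integers ℓ with 1 ≤ ℓ ≤ c·log₂ n, the polytope P_match(ℓ,n) has an extension described by at most n^k linear inequalities (together with linear equations); i.e., P_match(ℓ,n) admits a compact extended formulation when ℓ ≤ O(log n). -/

import Mathlib

open scoped BigOperators
open Classical in
noncomputable section

/-- Edges of the complete graph `K_n` on the node set `Fin n`. -/
abbrev Edge (n : ℕ) := {e : Sym2 (Fin n) // ¬ e.IsDiag}

/-- A matching: a set of pairwise node-disjoint edges. -/
def IsMatching {n : ℕ} (M : Finset (Edge n)) : Prop :=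
  ∀ e ∈ M, ∀ f ∈ M, e ≠ f → ∀ v : Fin n, ¬(v ∈ e.1 ∧ v ∈ f.1)

/-- Characteristic vector of a set of edges. -/
def charVec {n : ℕ} (M : Finset (Edge n)) : Edge n → ℝ :=
  fun e => if e ∈ M then 1 else 0

/-- `P_match(ℓ,n)`: convex hull of characteristic vectors of size-`ℓ` matchings of `K_n`. -/
def matchingPolytope (n ℓ : ℕ) : Set (Edge n → ℝ) :=
  convexHull ℝ {x | ∃ M : Finset (Edge n), IsMatching M ∧ M.card = ℓ ∧ x = charVec M}


/-- Greedy covering step, iterated `q` times. -/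
theorem greedy_cover {Φ X : Type} [Fintype Φ] [Nonempty Φ] (r : Φ → X → Prop)
    (D : ℕ) (U : Finset X)
    (hD : ∀ x ∈ U, ∀ [DecidablePred fun φ => r φ x],
      Fintype.card Φ ≤ D * (Finset.univ.filter fun φ => r φ x).card) (q : ℕ) :
    ∃ (F : Fin q → Φ) (V : Finset X), (∀ x ∈ U, (∀ i, ¬ r (F i) x) → x ∈ V) ∧ V ⊆ U ∧
      (V.card : ℝ) ≤ (1 - 1 / (D : ℝ)) ^ q * U.card := by
  classical
  induction q with
  | zero => exact ⟨fun i => i.elim0, U, fun x hx _ => hx, subset_rfl, by simp⟩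
  | succ q ih =>
    obtain ⟨F, V, hFV, hVU, hc⟩ := ih
    have hcard : (0 : ℝ) < Fintype.card Φ := by exact_mod_cast Fintype.card_pos
    by_cases hV : V = ∅
    · subst hV
      refine ⟨Fin.cons (Classical.arbitrary Φ) F, ∅, fun x hx h => hFV x hx fun i => ?_,
        by simp, ?_⟩
      · simpa using h i.succ
      · rcases Nat.eq_zero_or_pos D with h0 | h0
        · subst h0; simp
        · have : (1 : ℝ) / D ≤ 1 := by
            rw [div_le_one (by exact_mod_cast h0)]; exact_mod_cast h0
          have : (0 : ℝ) ≤ 1 - 1 / D := by linarith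
          simp only [Finset.card_empty, Nat.cast_zero]
          positivity
    have hDpos : 0 < D := by
      obtain ⟨x, hx⟩ := Finset.nonempty_iff_ne_empty.mpr hV
      have := hD x (hVU hx)
      rcases Nat.eq_zero_or_pos D with h0 | h0
      · subst h0
        have h2 : 0 < Fintype.card Φ := Fintype.card_pos
        omega
      · exact h0
    have hDr : (0 : ℝ) < D := by exact_mod_cast hDpos
    -- double counting
    have hdc : ∑ φ : Φ, ((V.filter fun x => r φ x).card : ℝ)
        = ∑ x ∈ V, ((Finset.univ.filter fun φ => r φ x).card : ℝ) := by
      exact_mod_cast Finset.sum_card_bipartiteAbove_eq_sum_card_bipartiteBelow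
        (s := Finset.univ) (t := V) r
    have hlow : ∑ φ : Φ, ((V.card : ℝ) / D) ≤ ∑ φ : Φ, ((V.filter fun x => r φ x).card : ℝ) := by
      rw [hdc]
      have : ∀ x ∈ V, (Fintype.card Φ : ℝ) / D ≤ ((Finset.univ.filter fun φ => r φ x).card : ℝ) := by
        intro x hx
        rw [div_le_iff₀ hDr]
        have := hD x (hVU hx)
        rw [mul_comm]
        exact_mod_cast this
      refine le_trans ?_ (Finset.sum_le_sum this)
      simp only [Finset.sum_const, Finset.card_univ, nsmul_eq_mul]
      apply le_of_eq; ring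
    obtain ⟨φ, -, hφ⟩ := Finset.exists_le_of_sum_le Finset.univ_nonempty hlow
    refine ⟨Fin.cons φ F, V.filter fun x => ¬ r φ x, ?_, ?_, ?_⟩
    · intro x hx h
      refine Finset.mem_filter.mpr ⟨hFV x hx fun i => ?_, ?_⟩
      · simpa using h i.succ
      · simpa using h 0
    · exact (Finset.filter_subset _ _).trans hVU
    · have h1 := Finset.card_filter_add_card_filter_not (s := V) (fun x => r φ x)
      have h2 : ((V.filter fun x => r φ x).card : ℝ) + ((V.filter fun x => ¬ r φ x).card : ℝ)
        = V.card := by exact_mod_cast h1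
      have h3 : ((V.filter fun x => ¬ r φ x).card : ℝ) ≤ (1 - 1 / D) * V.card := by
        have : (1 - 1 / (D : ℝ)) * V.card = V.card - V.card / D := by ring
        rw [this]; linarith
      have h4 : (1 : ℝ) / D ≤ 1 := by
        rw [div_le_one hDr]; exact_mod_cast hDpos
      calc _ ≤ _ := h3
        _ ≤ (1 - 1 / D) * ((1 - 1 / (D : ℝ)) ^ q * U.card) :=
          mul_le_mul_of_nonneg_left hc (by linarith)
        _ = _ := by ring

/-- Many colourings are injective on a given `k`-set. -/
theorem many_injective {n k : ℕ} (S : Finset (Fin n)) (hS : S.card = k)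
    [DecidablePred fun φ : Fin n → Fin (2 * k) => Set.InjOn φ S] :
    Fintype.card (Fin n → Fin (2 * k)) ≤
      2 ^ k * (Finset.univ.filter fun φ : Fin n → Fin (2 * k) => Set.InjOn φ S).card := by
  classical
  let e := Equiv.piEquivPiSubtypeProd (fun x : Fin n => x ∈ S) (fun _ => Fin (2 * k))
  have h1 : Fintype.card (Fin n → Fin (2 * k)) =
      (2 * k) ^ k * Fintype.card ({x : Fin n // x ∉ S} → Fin (2 * k)) := by
    rw [Fintype.card_congr e, Fintype.card_prod]
    congr 1
    rw [Fintype.card_fun]; simp [hS]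
  have h2 : (S ↪ Fin (2 * k)) × ({x : Fin n // x ∉ S} → Fin (2 * k)) ↪
      {φ : Fin n → Fin (2 * k) // Set.InjOn φ S} := by
    refine ⟨fun p => ⟨e.symm (p.1, p.2), ?_⟩, ?_⟩
    · intro x hx y hy hxy
      have hx' : x ∈ S := hx
      have hy' : y ∈ S := hy
      simp only [e, Equiv.piEquivPiSubtypeProd_symm_apply, hx', hy', dif_pos] at hxy
      simpa using p.1.injective hxy
    · intro p p' h
      have := e.symm.injective (congrArg Subtype.val h)
      simp only [Prod.mk.injEq] at this
      exact Prod.ext (DFunLike.coe_injective this.1) this.2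
  have h3 := Fintype.card_le_of_embedding h2
  rw [Fintype.card_prod, Fintype.card_embedding_eq, Fintype.card_coe, hS, Fintype.card_fin] at h3
  have h5 := Fintype.card_subtype (fun φ : Fin n → Fin (2 * k) => Set.InjOn φ S)
  have h4 : k ^ k ≤ (2 * k).descFactorial k := by
    refine le_trans (Nat.pow_le_pow_left ?_ k) (Nat.pow_sub_le_descFactorial (2 * k) k)
    omega
  rw [h1, mul_pow, mul_assoc]
  refine Nat.mul_le_mul_left _ (le_trans (Nat.mul_le_mul_right _ h4) ?_)
  rw [← h5]
  convert h3

/-- Perfect hash families of moderate size. -/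
theorem hash_family (n k : ℕ) (hn : 1 ≤ n) (hk : 1 ≤ k) :
    ∃ F : Fin (2 ^ k * n) → (Fin n → Fin (2 * k)),
      ∀ S : Finset (Fin n), S.card = k → ∃ i, Set.InjOn (F i) S := by
  classical
  have : Nonempty (Fin (2 * k)) := ⟨⟨0, by omega⟩⟩
  obtain ⟨F, V, hF, -, hV⟩ := greedy_cover
    (fun (φ : Fin n → Fin (2 * k)) (S : Finset (Fin n)) => Set.InjOn φ S) (2 ^ k)
    (Finset.univ.filter fun S => S.card = k)
    (fun S hS => by intro _; exact many_injective S (Finset.mem_filter.mp hS).2) (2 ^ k * n)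
  refine ⟨F, fun S hS => ?_⟩
  by_contra hcon
  push Not at hcon
  have hSV := hF S (by simp [hS]) hcon
  have h1 : (1 : ℝ) ≤ V.card := by
    exact_mod_cast Finset.card_pos.mpr ⟨S, hSV⟩
  have h2 : ((Finset.univ.filter fun S : Finset (Fin n) => S.card = k).card : ℝ) ≤ 2 ^ n := by
    have := Finset.card_filter_le (Finset.univ : Finset (Finset (Fin n))) (fun S => S.card = k)
    simp only [Finset.card_univ, Fintype.card_finset, Fintype.card_fin] at this
    exact_mod_cast this
  have h3 : (1 - 1 / ((2 ^ k : ℕ) : ℝ)) ^ (2 ^ k * n) ≤ Real.exp (-1) ^ n := by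
    rw [pow_mul]
    apply pow_le_pow_left₀
    · apply pow_nonneg
      have : (1 : ℝ) / ((2 ^ k : ℕ) : ℝ) ≤ 1 := by
        rw [div_le_one (by positivity)]
        exact_mod_cast Nat.one_le_two_pow
      linarith
    · exact Real.one_sub_div_pow_le_exp_neg (by exact_mod_cast Nat.one_le_two_pow)
  have h4 : (V.card : ℝ) ≤ (Real.exp (-1) * 2) ^ n := by
    rw [mul_pow]
    exact hV.trans (mul_le_mul h3 h2 (by positivity) (by positivity))
  have h5 : Real.exp (-1) * 2 < 1 := by
    rw [Real.exp_neg, inv_mul_lt_iff₀ (Real.exp_pos 1)]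
    have := Real.exp_one_gt_d9
    linarith
  have h6 : (Real.exp (-1) * 2) ^ n < 1 := pow_lt_one₀ (by positivity) h5 (by omega)
  linarith

/-- Vectors of directed walks of length `t` from an initial state to `s`. -/
def Walks {σ A V : Type} [AddCommGroup V] (src tgt : A → σ) (lab : A → V)
    (ini : σ → Prop) : ℕ → σ → Set V
  | 0, s => {v | ini s ∧ v = 0}
  | t + 1, s => {v | ∃ a, tgt a = s ∧ ∃ u ∈ Walks src tgt lab ini t (src a), v = u + lab a}

/-- Feasible unit flows in the layered network with `T` layers of arcs. -/
structure Feas {σ A : Type} [Fintype σ] [Fintype A] [DecidableEq σ] (src tgt : A → σ)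
    (ini : σ → Prop) (T : ℕ) (W : ℕ → σ → ℝ) (Y : ℕ → A → ℝ) : Prop where
  start : ∀ s, ¬ ini s → W 0 s = 0
  unit : ∑ s, W 0 s = 1
  out : ∀ t < T, ∀ s, W t s = ∑ a, if src a = s then Y t a else 0
  inn : ∀ t < T, ∀ s, W (t + 1) s = ∑ a, if tgt a = s then Y t a else 0

theorem walk_feas {σ A V : Type} [Fintype σ] [Fintype A] [DecidableEq σ] [AddCommGroup V]
    [Module ℝ V] (src tgt : A → σ) (lab : A → V) (ini : σ → Prop) (T : ℕ) :
    ∀ s, ∀ v ∈ Walks src tgt lab ini T s, ∃ (W : ℕ → σ → ℝ) (Y : ℕ → A → ℝ),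
      Feas src tgt ini T W Y ∧ (∀ t a, 0 ≤ Y t a) ∧ W T = Pi.single s 1 ∧
      ∑ t ∈ Finset.range T, ∑ a, Y t a • lab a = v := by
  classical
  induction T with
  | zero =>
    rintro s v ⟨hs, rfl⟩
    refine ⟨fun _ => Pi.single s 1, fun _ _ => 0, ⟨?_, ?_, by simp, by simp⟩, by simp, rfl, by simp⟩
    · intro s' hs'
      rw [Pi.single_eq_of_ne]
      rintro rfl; exact hs' hs
    · simp
  | succ T ih =>
    rintro s v ⟨a, ha, u, hu, rfl⟩
    obtain ⟨W, Y, hF, hY, hW, hsum⟩ := ih _ u hu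
    refine ⟨Function.update W (T + 1) (Pi.single s 1), Function.update Y T (Pi.single a 1),
      ⟨?_, ?_, ?_, ?_⟩, ?_, by simp, ?_⟩
    · intro s' hs'
      rw [Function.update_of_ne (by omega)]; exact hF.start s' hs'
    · rw [Function.update_of_ne (by omega)]; exact hF.unit
    · intro t ht s'
      rw [Function.update_of_ne (by omega)]
      rcases Nat.lt_succ_iff_lt_or_eq.mp ht with h | h
      · rw [Function.update_of_ne (by omega)]; exact hF.out t h s'
      · subst h
        rw [Function.update_self, hW]
        rw [Finset.sum_eq_single a]
        · by_cases h : src a = s'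
          · subst h; simp
          · simp [h, Ne.symm h]
        · intro b _ hb
          simp [hb]
        · simp
    · intro t ht s'
      rcases Nat.lt_succ_iff_lt_or_eq.mp ht with h | h
      · rw [Function.update_of_ne (by omega), Function.update_of_ne (by omega)]
        exact hF.inn t h s'
      · subst h
        rw [Function.update_self, Function.update_self]
        rw [Finset.sum_eq_single a]
        · by_cases h : tgt a = s'
          · subst h; simp [ha]
          · simp [h, ← ha, Ne.symm h]
        · intro b _ hb
          simp [hb]
        · simp
    · intro t b
      by_cases h : t = T
      · subst h
        rw [Function.update_self, Pi.single_apply]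
        split_ifs <;> norm_num
      · rw [Function.update_of_ne h]; exact hY t b
    · rw [Finset.sum_range_succ]
      congr 1
      · rw [← hsum]
        refine Finset.sum_congr rfl fun t ht => ?_
        have := Finset.mem_range.mp ht
        rw [Function.update_of_ne (by omega)]
      · rw [Function.update_self, Finset.sum_eq_single a]
        · simp
        · intro b _ hb; simp [hb]
        · simp

theorem flow_decomp {σ A V : Type} [Fintype σ] [Fintype A] [DecidableEq σ] [AddCommGroup V]
    [Module ℝ V] (src tgt : A → σ) (lab : A → V) (ini : σ → Prop) (T : ℕ)
    (W : ℕ → σ → ℝ) (Y : ℕ → A → ℝ) (hF : Feas src tgt ini T W Y)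
    (hY : ∀ t < T, ∀ a, 0 ≤ Y t a) :
    ∃ z : σ → V, (∀ s, W T s ≠ 0 → z s ∈ convexHull ℝ (Walks src tgt lab ini T s)) ∧
      ∑ s, W T s • z s = ∑ t ∈ Finset.range T, ∑ a, Y t a • lab a ∧ ∑ s, W T s = 1 := by
  classical
  induction T with
  | zero =>
    refine ⟨fun _ => 0, fun s hs => subset_convexHull ℝ _ ⟨?_, rfl⟩, by simp, hF.unit⟩
    by_contra h
    exact hs (hF.start s h)
  | succ T ih =>
    obtain ⟨z, hz, hsum, hone⟩ := ih ⟨hF.start, hF.unit, fun t ht => hF.out t (by omega),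
      fun t ht => hF.inn t (by omega)⟩ (fun t ht => hY t (by omega))
    have hYT := hY T (by omega)
    have hin := hF.inn T (by omega)
    have hout := hF.out T (by omega)
    have hterm : ∀ s a, 0 ≤ (if tgt a = s then Y T a else 0) := by
      intro s a; split_ifs; exacts [hYT a, le_rfl]
    have hterm' : ∀ s a, 0 ≤ (if src a = s then Y T a else 0) := by
      intro s a; split_ifs; exacts [hYT a, le_rfl]
    have hWnn : ∀ s, 0 ≤ W (T + 1) s := fun s => by
      rw [hin]; exact Finset.sum_nonneg fun a _ => hterm s a
    have hle : ∀ a, Y T a ≤ W (T + 1) (tgt a) := fun a => by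
      rw [hin]
      have := Finset.single_le_sum (fun b _ => hterm (tgt a) b) (Finset.mem_univ a)
      simpa using this
    have hle' : ∀ a, Y T a ≤ W T (src a) := fun a => by
      rw [hout]
      have := Finset.single_le_sum (fun b _ => hterm' (src a) b) (Finset.mem_univ a)
      simpa using this
    have hshift : ∀ a, ∀ v ∈ convexHull ℝ (Walks src tgt lab ini T (src a)),
        v + lab a ∈ convexHull ℝ (Walks src tgt lab ini (T + 1) (tgt a)) := by
      intro a v hv
      have : convexHull ℝ (Walks src tgt lab ini T (src a)) ⊆
          (fun z => z + lab a) ⁻¹' convexHull ℝ (Walks src tgt lab ini (T + 1) (tgt a)) := by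
        apply convexHull_min
        · intro u hu
          exact subset_convexHull ℝ _ ⟨a, rfl, u, hu, rfl⟩
        · exact (convex_convexHull ℝ _).translate_preimage_left _
      exact this hv
    have hWe : ∀ s, ∑ a, (if tgt a = s then Y T a else 0) = W (T + 1) s := fun s => (hin s).symm
    refine ⟨fun s => ∑ a, ((if tgt a = s then Y T a else 0) / W (T + 1) s) • (z (src a) + lab a),
      ?_, ?_, ?_⟩
    · intro s hs
      beta_reduce
      rw [← finsum_eq_sum_of_fintype]
      apply (convex_convexHull ℝ _).finsum_mem
      · intro a; exact div_nonneg (hterm s a) (hWnn s)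
      · rw [finsum_eq_sum_of_fintype, ← Finset.sum_div, hWe, div_self hs]
      · intro a ha
        by_cases h : tgt a = s
        · subst h
          apply hshift
          apply hz
          rw [if_pos rfl] at ha
          have hne : Y T a ≠ 0 := fun h0 => ha (by rw [h0]; simp)
          have := lt_of_le_of_ne (hYT a) (Ne.symm hne)
          exact (this.trans_le (hle' a)).ne'
        · simp [h] at ha
    · have h1 : ∀ s, W (T + 1) s • ∑ a, ((if tgt a = s then Y T a else 0) / W (T + 1) s) •
          (z (src a) + lab a) = ∑ a, if tgt a = s then Y T a • (z (src a) + lab a) else 0 := by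
        intro s
        rw [Finset.smul_sum]
        refine Finset.sum_congr rfl fun a _ => ?_
        rw [smul_smul]
        by_cases h : tgt a = s
        · rw [if_pos h, if_pos h]
          congr 1
          by_cases hw : W (T + 1) s = 0
          · have := hle a
            rw [h, hw] at this
            rw [hw, zero_mul]
            exact le_antisymm (hYT a) this
          · field_simp
        · simp [h]
      simp only [h1]
      rw [Finset.sum_comm, Finset.sum_range_succ, ← hsum]
      simp only [Finset.sum_ite_eq, Finset.mem_univ, if_true, smul_add, Finset.sum_add_distrib]
      congr 1
      have h2 : ∀ s, W T s • z s = ∑ a, if src a = s then Y T a • z (src a) else 0 := by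
        intro s
        rw [hout, Finset.sum_smul]
        refine Finset.sum_congr rfl fun a _ => ?_
        by_cases h : src a = s
        · simp [h]
        · simp [h]
      simp only [h2]
      rw [Finset.sum_comm]
      simp
    · simp only [hin]
      rw [Finset.sum_comm, ← hone]
      simp only [hout]
      rw [Finset.sum_comm (f := fun s a => if src a = s then Y T a else 0)]
      simp

/-- The layered flow polytope is an extension of the hull of walk vectors. -/
theorem flow_image {σ A V : Type} [Fintype σ] [Fintype A] [DecidableEq σ] [AddCommGroup V]
    [Module ℝ V] (src tgt : A → σ) (lab : A → V) (ini : σ → Prop) (T : ℕ) (hT : 1 ≤ T) (v : V) :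
    (∃ W Y, Feas src tgt ini T W Y ∧ (∀ t < T, ∀ a, 0 ≤ Y t a) ∧
      ∑ t ∈ Finset.range T, ∑ a, Y t a • lab a = v) ↔
    v ∈ convexHull ℝ {v | ∃ s, v ∈ Walks src tgt lab ini T s} := by
  constructor
  · rintro ⟨W, Y, hF, hY, rfl⟩
    obtain ⟨z, hz, hsum, hone⟩ := flow_decomp src tgt lab ini T W Y hF hY
    rw [← hsum, ← finsum_eq_sum_of_fintype]
    apply (convex_convexHull ℝ _).finsum_mem
    · intro s
      obtain ⟨t, rfl⟩ : ∃ t, T = t + 1 := ⟨T - 1, by omega⟩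
      rw [hF.inn t (by omega)]
      refine Finset.sum_nonneg fun a _ => ?_
      split_ifs; exacts [hY t (by omega) a, le_rfl]
    · rw [finsum_eq_sum_of_fintype, hone]
    · intro s hs
      have hsub : Walks src tgt lab ini T s ⊆ {v | ∃ s, v ∈ Walks src tgt lab ini T s} :=
        fun u hu => ⟨s, hu⟩
      exact convexHull_mono hsub (hz s hs)
  · intro hv
    have : convexHull ℝ {v | ∃ s, v ∈ Walks src tgt lab ini T s} ⊆
        {v | ∃ W Y, Feas src tgt ini T W Y ∧ (∀ t < T, ∀ a, 0 ≤ Y t a) ∧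
      ∑ t ∈ Finset.range T, ∑ a, Y t a • lab a = v} := by
      apply convexHull_min
      · rintro u ⟨s, hu⟩
        obtain ⟨W, Y, hF, hY, -, h⟩ := walk_feas src tgt lab ini T s u hu
        exact ⟨W, Y, hF, fun t _ => hY t, h⟩
      · rintro u ⟨W, Y, hF, hY, rfl⟩ u' ⟨W', Y', hF', hY', rfl⟩ p q hp hq hpq
        refine ⟨p • W + q • W', p • Y + q • Y', ⟨?_, ?_, ?_, ?_⟩, ?_, ?_⟩
        · intro s hs; simp [hF.start s hs, hF'.start s hs]
        · simp only [Pi.add_apply, Pi.smul_apply, smul_eq_mul, Finset.sum_add_distrib,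
            ← Finset.mul_sum, hF.unit, hF'.unit, mul_one, hpq]
        · intro t ht s
          simp only [Pi.add_apply, Pi.smul_apply, smul_eq_mul, hF.out t ht s, hF'.out t ht s,
            Finset.mul_sum, ← Finset.sum_add_distrib]
          refine Finset.sum_congr rfl fun a _ => ?_
          split_ifs <;> simp
        · intro t ht s
          simp only [Pi.add_apply, Pi.smul_apply, smul_eq_mul, hF.inn t ht s, hF'.inn t ht s,
            Finset.mul_sum, ← Finset.sum_add_distrib]
          refine Finset.sum_congr rfl fun a _ => ?_
          split_ifs <;> simp
        · intro t ht a
          have h1 := hY t ht a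
          have h2 := hY' t ht a
          simp only [Pi.add_apply, Pi.smul_apply, smul_eq_mul]
          positivity
        · simp only [Pi.add_apply, Pi.smul_apply, Finset.smul_sum, ← Finset.sum_add_distrib,
            add_smul, smul_assoc]
    exact this hv

/-- From abstract linear systems to systems given by matrices indexed by `Fin`. -/
theorem ext_lin {I κ ρ E : Type} [Fintype I] [Fintype κ] [Fintype ρ]
    (L : κ → (I → ℝ) →ₗ[ℝ] ℝ) (bq : κ → ℝ) (J : ρ → I) (P : (I → ℝ) →ₗ[ℝ] (E → ℝ)) :
    ∃ (d g f : ℕ) (Aeq : Fin g → Fin d → ℝ) (beq : Fin g → ℝ)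
        (A : Fin f → Fin d → ℝ) (b : Fin f → ℝ)
        (p : (Fin d → ℝ) →ᵃ[ℝ] (E → ℝ)),
        f = Fintype.card ρ ∧
        p '' {y : Fin d → ℝ |
            (∀ i : Fin g, ∑ j, Aeq i j * y j = beq i) ∧
            (∀ i : Fin f, ∑ j, A i j * y j ≤ b i)} =
        P '' {x | (∀ k, L k x = bq k) ∧ ∀ r, 0 ≤ x (J r)} := by
  classical
  let eI := Fintype.equivFin I
  let eκ := Fintype.equivFin κ
  let eρ := Fintype.equivFin ρ
  let R : (Fin (Fintype.card I) → ℝ) ≃ₗ[ℝ] (I → ℝ) := LinearEquiv.funCongrLeft ℝ ℝ eI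
  have hR : ∀ y i, R y i = y (eI i) := fun y i => rfl
  have hL : ∀ k y, ∑ j, L k (Pi.single (eI.symm j) 1) * y j = L k (R y) := by
    intro k y
    have : R y = ∑ j, y j • (Pi.single (eI.symm j) 1 : I → ℝ) := by
      ext i
      rw [hR, Finset.sum_apply, Finset.sum_eq_single (eI i)]
      · simp
      · intro j _ hj
        have : i ≠ eI.symm j := fun h => hj (by rw [h]; simp)
        simp [this]
      · simp
    rw [this, map_sum]
    refine Finset.sum_congr rfl fun j _ => ?_
    rw [map_smul, smul_eq_mul, mul_comm]
  refine ⟨Fintype.card I, Fintype.card κ, Fintype.card ρ,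
    fun i j => L (eκ.symm i) (Pi.single (eI.symm j) 1), fun i => bq (eκ.symm i),
    fun i j => if j = eI (J (eρ.symm i)) then -1 else 0, fun _ => 0,
    (P ∘ₗ R.toLinearMap).toAffineMap, rfl, ?_⟩
  ext v
  constructor
  · rintro ⟨y, ⟨h1, h2⟩, rfl⟩
    refine ⟨R y, ⟨fun k => ?_, fun r => ?_⟩, rfl⟩
    · have := h1 (eκ k)
      rw [hL] at this
      simpa using this
    · have := h2 (eρ r)
      simp only [ite_mul, zero_mul, Finset.sum_ite_eq', Finset.mem_univ, if_true,
        Equiv.symm_apply_apply] at this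
      rw [hR]; linarith
  · rintro ⟨x, ⟨h1, h2⟩, rfl⟩
    refine ⟨R.symm x, ⟨fun k => ?_, fun r => ?_⟩, ?_⟩
    · rw [hL, LinearEquiv.apply_symm_apply]; exact h1 _
    · have := h2 (eρ.symm r)
      simp only [ite_mul, zero_mul, Finset.sum_ite_eq', Finset.mem_univ, if_true]
      have h3 := hR (R.symm x) (J (eρ.symm r))
      rw [LinearEquiv.apply_symm_apply] at h3
      rw [← h3]; linarith
    · simp

/-- The hull of walk vectors has an extension with one inequality per layer and arc. -/
theorem walk_extension {σ A E : Type} [Fintype σ] [Fintype A] [DecidableEq σ]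
    (src tgt : A → σ) (lab : A → (E → ℝ)) (ini : σ → Prop) (T : ℕ) (hT : 1 ≤ T) :
    ∃ (d g f : ℕ) (Aeq : Fin g → Fin d → ℝ) (beq : Fin g → ℝ)
        (B : Fin f → Fin d → ℝ) (b : Fin f → ℝ)
        (p : (Fin d → ℝ) →ᵃ[ℝ] (E → ℝ)),
        f = T * Fintype.card A ∧
        p '' {y : Fin d → ℝ |
            (∀ i : Fin g, ∑ j, Aeq i j * y j = beq i) ∧
            (∀ i : Fin f, ∑ j, B i j * y j ≤ b i)} =
        convexHull ℝ {v | ∃ s, v ∈ Walks src tgt lab ini T s} := by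
  classical
  let I := (Fin (T + 1) × σ) ⊕ (Fin T × A)
  let pr : I → (I → ℝ) →ₗ[ℝ] ℝ := fun i => LinearMap.proj i
  let L : σ ⊕ Unit ⊕ (Fin T × σ) ⊕ (Fin T × σ) → (I → ℝ) →ₗ[ℝ] ℝ :=
    Sum.elim (fun s => (if ini s then (0 : ℝ) else 1) • pr (Sum.inl (0, s)))
    (Sum.elim (fun _ => ∑ s, pr (Sum.inl (0, s)))
    (Sum.elim
      (fun q => pr (Sum.inl (q.1.castSucc, q.2)) -
        ∑ a, (if src a = q.2 then (1 : ℝ) else 0) • pr (Sum.inr (q.1, a)))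
      (fun q => pr (Sum.inl (q.1.succ, q.2)) -
        ∑ a, (if tgt a = q.2 then (1 : ℝ) else 0) • pr (Sum.inr (q.1, a)))))
  let bq : σ ⊕ Unit ⊕ (Fin T × σ) ⊕ (Fin T × σ) → ℝ :=
    Sum.elim (fun _ => 0) (Sum.elim (fun _ => 1) (fun _ => 0))
  let P : (I → ℝ) →ₗ[ℝ] (E → ℝ) := ∑ t : Fin T, ∑ a, (pr (Sum.inr (t, a))).smulRight (lab a)
  obtain ⟨d, g, f, Aeq, beq, B, b, p, hf, hp⟩ := ext_lin L bq (fun r : Fin T × A => Sum.inr r) P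
  refine ⟨d, g, f, Aeq, beq, B, b, p, ?_, ?_⟩
  · rw [hf, Fintype.card_prod, Fintype.card_fin]
  rw [hp]
  ext v
  rw [← flow_image src tgt lab ini T hT v]
  have hP : ∀ x, P x = ∑ t : Fin T, ∑ a, x (Sum.inr (t, a)) • lab a := by
    intro x
    simp [P, pr, LinearMap.sum_apply]
  constructor
  · rintro ⟨x, ⟨h1, h2⟩, rfl⟩
    refine ⟨fun t s => if h : t < T + 1 then x (Sum.inl (⟨t, h⟩, s)) else 0,
      fun t a => if h : t < T then x (Sum.inr (⟨t, h⟩, a)) else 0, ⟨?_, ?_, ?_, ?_⟩, ?_, ?_⟩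
    · intro s hs
      have := h1 (Sum.inl s)
      simpa [L, bq, pr, hs] using this
    · have := h1 (Sum.inr (Sum.inl ()))
      simpa [L, bq, pr, LinearMap.sum_apply] using this
    · intro t ht s
      have := h1 (Sum.inr (Sum.inr (Sum.inl (⟨t, ht⟩, s))))
      simp only [L, bq, pr, Sum.elim_inr, Sum.elim_inl, LinearMap.sub_apply, LinearMap.sum_apply,
        LinearMap.smul_apply, LinearMap.proj_apply, smul_eq_mul, ite_mul, one_mul, zero_mul,
        sub_eq_zero, Fin.castSucc_mk] at this
      simpa [ht, Nat.lt_succ_of_lt ht] using this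
    · intro t ht s
      have := h1 (Sum.inr (Sum.inr (Sum.inr (⟨t, ht⟩, s))))
      simp only [L, bq, pr, Sum.elim_inr, LinearMap.sub_apply, LinearMap.sum_apply,
        LinearMap.smul_apply, LinearMap.proj_apply, smul_eq_mul, ite_mul, one_mul, zero_mul,
        sub_eq_zero, Fin.succ_mk] at this
      simpa [ht] using this
    · intro t ht a
      simp only [ht, dif_pos]
      exact h2 (⟨t, ht⟩, a)
    · rw [hP, Finset.sum_range]
      simp
  · rintro ⟨W, Y, hF, hY, rfl⟩
    refine ⟨Sum.elim (fun q => W q.1 q.2) (fun q => Y q.1 q.2), ⟨?_, ?_⟩, ?_⟩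
    · rintro (s | _ | ⟨t, s⟩ | ⟨t, s⟩)
      · by_cases hs : ini s
        · simp [L, bq, hs]
        · simp [L, bq, pr, hs, hF.start s hs]
      · simp [L, bq, pr, LinearMap.sum_apply, hF.unit]
      · have := hF.out t t.2 s
        simp only [L, bq, pr, Sum.elim_inr, Sum.elim_inl, LinearMap.sub_apply,
          LinearMap.sum_apply, LinearMap.smul_apply, LinearMap.proj_apply, smul_eq_mul, ite_mul,
          one_mul, zero_mul, sub_eq_zero]
        simpa using this
      · have := hF.inn t t.2 s
        simp only [L, bq, pr, Sum.elim_inr, Sum.elim_inl, LinearMap.sub_apply,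
          LinearMap.sum_apply, LinearMap.smul_apply, LinearMap.proj_apply, smul_eq_mul, ite_mul,
          one_mul, zero_mul, sub_eq_zero]
        simpa using this
    · rintro ⟨t, a⟩
      exact hY t t.2 a
    · rw [hP, Finset.sum_range]
      simp

/-- The vertices of an edge set. -/
def verts {n : ℕ} (M : Finset (Edge n)) : Finset (Fin n) := M.biUnion fun e => e.1.toFinset

/-- Arcs of the colouring network. -/
abbrev CArc (n m q : ℕ) (F : Fin q → Fin n → Fin m) :=
  {a : Fin q × Finset (Fin m) × Edge n //
    Set.InjOn (F a.1) a.2.2.1.toFinset ∧ Disjoint a.2.1 (a.2.2.1.toFinset.image (F a.1))}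

def csrc {n m q : ℕ} (F : Fin q → Fin n → Fin m) (a : CArc n m q F) : Fin q × Finset (Fin m) :=
  (a.1.1, a.1.2.1)

def ctgt {n m q : ℕ} (F : Fin q → Fin n → Fin m) (a : CArc n m q F) : Fin q × Finset (Fin m) :=
  (a.1.1, a.1.2.1 ∪ a.1.2.2.1.toFinset.image (F a.1.1))

def clab {n m q : ℕ} (F : Fin q → Fin n → Fin m) (a : CArc n m q F) : Edge n → ℝ :=
  charVec {a.1.2.2}

def colorStart {m q : ℕ} (s : Fin q × Finset (Fin m)) : Prop := s.2 = ∅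

theorem charVec_insert {n : ℕ} (M : Finset (Edge n)) (e : Edge n) (he : e ∉ M) :
    charVec (insert e M) = charVec M + charVec {e} := by
  ext f
  simp only [charVec, Pi.add_apply, Finset.mem_insert, Finset.mem_singleton]
  by_cases h : f = e
  · subst h; simp [he]
  · simp [h]

theorem walk_is_matching {n m q : ℕ} (F : Fin q → Fin n → Fin m) (t : ℕ) :
    ∀ s, ∀ v ∈ Walks (csrc F) (ctgt F) (clab F) colorStart t s,
      ∃ M : Finset (Edge n), IsMatching M ∧ M.card = t ∧ v = charVec M ∧
        (verts M).image (F s.1) = s.2 := by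
  induction t with
  | zero =>
    rintro s v ⟨hs, rfl⟩
    refine ⟨∅, by simp [IsMatching], rfl, ?_, ?_⟩
    · ext f; simp [charVec]
    · rw [show s.2 = ∅ from hs]; simp [verts]
  | succ t ih =>
    rintro s v ⟨a, rfl, u, hu, rfl⟩
    obtain ⟨M, hM, hc, rfl, himg⟩ := ih _ u hu
    obtain ⟨⟨i, S, e⟩, hinj, hdis⟩ := a
    simp only [csrc, ctgt, clab] at *
    have hno : ∀ f ∈ M, ∀ v, ¬ (v ∈ e.1 ∧ v ∈ f.1) := by
      rintro f hf v ⟨h1, h2⟩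
      have h3 : F i v ∈ S := by
        rw [← himg]
        exact Finset.mem_image_of_mem _ (Finset.mem_biUnion.mpr ⟨f, hf, Sym2.mem_toFinset.mpr h2⟩)
      have h4 : F i v ∈ e.1.toFinset.image (F i) :=
        Finset.mem_image_of_mem _ (Sym2.mem_toFinset.mpr h1)
      exact Finset.disjoint_left.mp hdis h3 h4
    have he : e ∉ M := fun h => hno e h (Quot.out e.1).1 ⟨Sym2.out_fst_mem _, Sym2.out_fst_mem _⟩
    refine ⟨insert e M, ?_, ?_, ?_, ?_⟩
    · intro x hx y hy hxy v hv
      rw [Finset.mem_insert] at hx hy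
      rcases hx with rfl | hx <;> rcases hy with rfl | hy
      · exact hxy rfl
      · exact hno y hy v hv
      · exact hno x hx v hv.symm
      · exact hM x hx y hy hxy v hv
    · rw [Finset.card_insert_of_notMem he, hc]
    · rw [charVec_insert M e he]
    · rw [verts, Finset.biUnion_insert, Finset.image_union, Finset.union_comm]
      rw [verts] at himg
      rw [himg]

theorem matching_is_walk {n m q : ℕ} (F : Fin q → Fin n → Fin m) (i : Fin q)
    (M : Finset (Edge n)) : IsMatching M → Set.InjOn (F i) (verts M) →
      charVec M ∈ Walks (csrc F) (ctgt F) (clab F) colorStart M.card (i, (verts M).image (F i)) := by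
  induction M using Finset.induction_on with
  | empty =>
    intro _ _
    refine ⟨by simp [verts, colorStart], ?_⟩
    ext f; simp [charVec]
  | insert e M he ih =>
    intro hM hinj
    have hv : verts (insert e M) = e.1.toFinset ∪ verts M := by
      rw [verts, Finset.biUnion_insert, verts]
    rw [hv] at hinj ⊢
    rw [Finset.coe_union] at hinj
    rw [Finset.card_insert_of_notMem he]
    have h1 := ih (fun x hx y hy => hM x (Finset.mem_insert_of_mem hx) y
      (Finset.mem_insert_of_mem hy)) (hinj.mono Set.subset_union_right)
    have hdis : Disjoint ((verts M).image (F i)) (e.1.toFinset.image (F i)) := by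
      rw [Finset.disjoint_left]
      intro c hc hc'
      obtain ⟨x, hx, rfl⟩ := Finset.mem_image.mp hc
      obtain ⟨y, hy, hxy⟩ := Finset.mem_image.mp hc'
      have : y = x := hinj (Or.inl hy) (Or.inr hx) hxy
      subst this
      obtain ⟨f, hf, hyf⟩ := Finset.mem_biUnion.mp hx
      exact hM e (Finset.mem_insert_self _ _) f (Finset.mem_insert_of_mem hf)
        (fun h => he (h ▸ hf)) y ⟨Sym2.mem_toFinset.mp hy, Sym2.mem_toFinset.mp hyf⟩
    refine ⟨⟨(i, (verts M).image (F i), e), hinj.mono Set.subset_union_left, hdis⟩, ?_,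
      charVec M, h1, ?_⟩
    · simp only [ctgt]
      rw [Finset.image_union, Finset.union_comm]
    · rw [charVec_insert M e he]; rfl

theorem card_verts {n : ℕ} (M : Finset (Edge n)) (hM : IsMatching M) :
    (verts M).card = 2 * M.card := by
  rw [verts, Finset.card_biUnion]
  · rw [Finset.sum_congr rfl fun e _ => Sym2.card_toFinset_of_not_isDiag e.1 e.2]
    simp [mul_comm]
  · intro e he f hf hef
    refine Finset.disjoint_left.mpr ?_
    intro v h1 h2
    exact hM e he f hf hef v ⟨Sym2.mem_toFinset.mp h1, Sym2.mem_toFinset.mp h2⟩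

theorem card_edge_le (n : ℕ) : Fintype.card (Edge n) ≤ n ^ 2 := by
  have h : Fintype.card (Edge n) ≤ Fintype.card (Fin n × Fin n) :=
    Fintype.card_le_of_injective (fun e => Quot.out e.1) (by
      intro e f hef
      apply Subtype.ext
      rw [← Quot.out_eq e.1, ← Quot.out_eq f.1]
      exact congrArg _ hef)
  simpa [sq] using h

/-- Corollary 4.2.  For every constant `c > 0` there is `k ∈ ℕ` such
that for all `n ≥ 2` and all `1 ≤ ℓ ≤ c·log₂ n`, the polytope `P_match(ℓ,n)` has an
extension described by at most `n^k` linear inequalities (together with linear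
equations): `P_match(ℓ,n)` admits a compact extended formulation for `ℓ ≤ O(log n)`. -/
theorem statement12 (c : ℝ) (hc : 0 < c) :
    ∃ k : ℕ, ∀ n ℓ : ℕ, 2 ≤ n → 1 ≤ ℓ → (ℓ : ℝ) ≤ c * Real.logb 2 (n : ℝ) →
      ∃ (d g f : ℕ) (Aeq : Fin g → Fin d → ℝ) (beq : Fin g → ℝ)
        (A : Fin f → Fin d → ℝ) (b : Fin f → ℝ)
        (p : (Fin d → ℝ) →ᵃ[ℝ] (Edge n → ℝ)),
        f ≤ n ^ k ∧
        p '' {y : Fin d → ℝ |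
            (∀ i : Fin g, ∑ j, Aeq i j * y j = beq i) ∧
            (∀ i : Fin f, ∑ j, A i j * y j ≤ b i)} = matchingPolytope n ℓ := by
  refine ⟨7 * ⌈c⌉₊ + 3, fun n ℓ hn hℓ hle => ?_⟩
  obtain ⟨F, hF⟩ := hash_family n (2 * ℓ) (by omega) (by omega)
  obtain ⟨d, g, f, Aeq, beq, A, b, p, hf, hp⟩ :=
    walk_extension (csrc F) (ctgt F) (clab F) colorStart ℓ hℓ
  refine ⟨d, g, f, Aeq, beq, A, b, p, ?_, ?_⟩
  · have h1 : Fintype.card (CArc n (2 * (2 * ℓ)) (2 ^ (2 * ℓ) * n) F) ≤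
        (2 ^ (2 * ℓ) * n) * (2 ^ (2 * (2 * ℓ)) * n ^ 2) := by
      refine (Fintype.card_subtype_le _).trans ?_
      rw [Fintype.card_prod, Fintype.card_prod, Fintype.card_finset, Fintype.card_fin,
        Fintype.card_fin]
      exact Nat.mul_le_mul_left _ (Nat.mul_le_mul_left _ (card_edge_le n))
    have h2 : 2 ^ ℓ ≤ n ^ ⌈c⌉₊ := by
      have hn0 : (0 : ℝ) < n := by exact_mod_cast (by omega : 0 < n)
      have hn1 : (1 : ℝ) ≤ n := by exact_mod_cast (by omega : 1 ≤ n)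
      have : ((2 : ℝ)) ^ ℓ ≤ (n : ℝ) ^ ⌈c⌉₊ := by
        rw [← Real.rpow_natCast, ← Real.rpow_natCast]
        calc (2 : ℝ) ^ (ℓ : ℝ) ≤ 2 ^ (c * Real.logb 2 n) :=
              Real.rpow_le_rpow_of_exponent_le (by norm_num) hle
          _ = (n : ℝ) ^ c := by
              rw [mul_comm, Real.rpow_mul (by norm_num),
                Real.rpow_logb (by norm_num) (by norm_num) hn0]
          _ ≤ (n : ℝ) ^ ((⌈c⌉₊ : ℕ) : ℝ) :=
              Real.rpow_le_rpow_of_exponent_le hn1 (Nat.le_ceil c)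
      exact_mod_cast this
    calc f = ℓ * _ := hf
      _ ≤ 2 ^ ℓ * ((2 ^ (2 * ℓ) * n) * (2 ^ (2 * (2 * ℓ)) * n ^ 2)) :=
          Nat.mul_le_mul Nat.lt_two_pow_self.le h1
      _ = (2 ^ ℓ) ^ 7 * n ^ 3 := by ring
      _ ≤ (n ^ ⌈c⌉₊) ^ 7 * n ^ 3 := Nat.mul_le_mul_right _ (Nat.pow_le_pow_left h2 7)
      _ = n ^ (7 * ⌈c⌉₊ + 3) := by ring
  · rw [hp, matchingPolytope]
    congr 1
    ext v
    constructor
    · rintro ⟨s, hv⟩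
      obtain ⟨M, h1, h2, h3, -⟩ := walk_is_matching F ℓ s v hv
      exact ⟨M, h1, h2, h3⟩
    · rintro ⟨M, h1, rfl, rfl⟩
      obtain ⟨i, hi⟩ := hF (verts M) (card_verts M h1)
      exact ⟨_, matching_is_walk F i M h1 hi⟩

end
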